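/- arXiv:1608.03215 — 2 statements merged into one kernel-verified Lean document; each statement's English description precedes it below -/
import Mathlib

section
/- Let q be a prime power, n a positive integer, m a positive integer dividing q^n − 1, and α ∈ 𝔽_{q^n}^*. Let V be a k-dimensional and U an l-dimensional 𝔽_q-subspace of 𝔽_{q^n} with V ≠ U, and suppose their subspace polynomials have the forms L_V(X) = X^{q^k} + Σ_{j=0}^{t} a_j X^{q^j} with a_t ≠ 0 (t < k) and L_U(X) = X^{q^l} + Σ_{j=0}^{s} b_j X^{q^j} with b_s ≠ 0 (s < l). If k ≤ l, then dim_{𝔽_q}(α^m V ∩ α^m U) ≤ max(s, t + l − k). -/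
open Polynomial

/-- The `m`-quasi cyclic shift of a subspace `V` by `a`: `a • V = {a * v : v ∈ V}`. -/
noncomputable def qshift {K F : Type*} [Field K] [Field F] [Algebra K F]
    (a : F) (V : Submodule K F) : Submodule K F :=
  V.map (LinearMap.mulLeft K a)

/-- The subspace polynomial `L_V(X) = ∏_{v ∈ V} (X - v)` of a subspace `V` of a
finite field. -/
noncomputable def subspacePoly {K F : Type*} [Field K] [Field F] [Algebra K F] [Fintype F]
    (V : Submodule K F) : F[X] :=
  ∏ v ∈ (Set.toFinite (V : Set F)).toFinset, (X - C v)

/-- The subspace distance `d(U,V) = dim U + dim V - 2 dim (U ⊓ V)`. -/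
noncomputable def subspaceDist {K F : Type*} [Field K] [Field F] [Algebra K F]
    (U V : Submodule K F) : ℕ :=
  Module.finrank K U + Module.finrank K V - 2 * Module.finrank K ↥(U ⊓ V)

theorem dim_inter_shift_le_of_subspacePoly_forms
    {K F : Type*} [Field K] [Fintype K] [Field F] [Fintype F] [Algebra K F]
    (q n m k l t s : ℕ) (hq : Fintype.card K = q) (hn : 0 < n)
    (hF : Module.finrank K F = n) (hm : 0 < m) (hmdvd : m ∣ q ^ n - 1)
    (α : F) (hα : α ≠ 0)
    (V U : Submodule K F) (hVU : V ≠ U)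
    (hVk : Module.finrank K V = k) (hUl : Module.finrank K U = l)
    (a b : ℕ → F) (htk : t < k) (hsl : s < l)
    (hLV : subspacePoly V =
      X ^ q ^ k + ∑ j ∈ Finset.range (t + 1), C (a j) * X ^ q ^ j)
    (hat : a t ≠ 0)
    (hLU : subspacePoly U =
      X ^ q ^ l + ∑ j ∈ Finset.range (s + 1), C (b j) * X ^ q ^ j)
    (hbs : b s ≠ 0)
    (hkl : k ≤ l) :
    Module.finrank K ↥(qshift (α ^ m) V ⊓ qshift (α ^ m) U) ≤ max s (t + l - k) := by
  classical
  obtain ⟨d, rfl⟩ := Nat.exists_eq_add_of_le hkl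
  have hq1 : 1 < q := hq ▸ Fintype.one_lt_card
  have hmem : ∀ (W : Submodule K F) (x : F), (subspacePoly W).eval x = 0 ↔ x ∈ W := by
    intro W x
    simp [subspacePoly, eval_prod, Finset.prod_eq_zero_iff, sub_eq_zero]
  -- the iterated Frobenius
  obtain ⟨φ, hφ⟩ : ∃ φ : F[X] →+* F[X], ∀ p, φ p = p ^ q ^ d := by
    refine ⟨((FiniteField.frobeniusAlgHom K F[X]) ^ d : F[X] →ₐ[K] F[X]).toRingHom, fun p => ?_⟩
    change ((FiniteField.frobeniusAlgHom K F[X]) ^ d : F[X] →ₐ[K] F[X]) p = _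
    clear * - hq
    induction d with
    | zero => simp
    | succ d ih =>
      rw [pow_succ', AlgHom.mul_apply, ih, FiniteField.coe_frobeniusAlgHom, pow_succ, pow_mul, hq]
  set M := max s (t + d) with hM
  set P : F[X] := (subspacePoly V) ^ q ^ d - subspacePoly U with hP
  have hPdeg : P.natDegree ≤ q ^ M := by
    have : P = (∑ j ∈ Finset.range (t + 1), C (a j ^ q ^ d) * X ^ q ^ (j + d))
        - ∑ j ∈ Finset.range (s + 1), C (b j) * X ^ q ^ j := by
      rw [hP, ← hφ, hLV, hLU, map_add, map_sum, hφ, ← pow_mul, ← pow_add, add_sub_add_left_eq_sub]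
      congr 1
      refine Finset.sum_congr rfl fun j _ => ?_
      rw [hφ, mul_pow, ← C_pow, ← pow_mul, ← pow_add]
    rw [this]
    refine (natDegree_sub_le _ _).trans (max_le ?_ ?_)
    · refine natDegree_sum_le_of_forall_le _ _ fun j hj => (natDegree_C_mul_X_pow_le _ _).trans ?_
      have := Finset.mem_range.1 hj
      exact Nat.pow_le_pow_right (by omega) (by omega)
    · refine natDegree_sum_le_of_forall_le _ _ fun j hj => (natDegree_C_mul_X_pow_le _ _).trans ?_
      have := Finset.mem_range.1 hj
      exact Nat.pow_le_pow_right (by omega) (by omega)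
  have hqd : q ^ d ≠ 0 := pow_ne_zero _ (by omega)
  have hP0 : P ≠ 0 := by
    intro h
    apply hVU
    have h' : (subspacePoly V) ^ q ^ d = subspacePoly U := sub_eq_zero.1 h
    ext x
    rw [← hmem V, ← hmem U, ← h', eval_pow, pow_eq_zero_iff hqd]
  have hshift : qshift (α ^ m) V ⊓ qshift (α ^ m) U = (V ⊓ U).map (LinearMap.mulLeft K (α ^ m)) := by
    rw [Submodule.map_inf _ (mul_right_injective₀ (pow_ne_zero m hα))]
    rfl
  have hfin : Module.finrank K ↥(qshift (α ^ m) V ⊓ qshift (α ^ m) U)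
      = Module.finrank K ↥(V ⊓ U) := by
    rw [hshift]
    exact (Submodule.equivMapOfInjective _ (mul_right_injective₀ (pow_ne_zero m hα)) (V ⊓ U)).finrank_eq.symm
  have hcard : q ^ Module.finrank K ↥(V ⊓ U) ≤ q ^ M := by
    rw [← hq, ← Module.card_eq_pow_finrank (K := K) (V := ↥(V ⊓ U)), hq]
    refine le_trans ?_ hPdeg
    have h2 : (Finset.univ.filter fun x => x ∈ V ⊓ U).card ≤ P.natDegree := by
      refine Polynomial.card_le_degree_of_subset_roots (p := P) fun x hx => ?_
      have hx' : x ∈ V ⊓ U := by simpa using hx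
      rw [mem_roots hP0, IsRoot, hP, eval_sub, eval_pow, (hmem V x).2 hx'.1, (hmem U x).2 hx'.2,
        zero_pow hqd, sub_zero]
    rw [Fintype.card_subtype]
    exact h2
  rw [hfin, show t + (k + d) - k = t + d by omega]
  exact (Nat.pow_le_pow_iff_right hq1).1 hcard
end

section
/- Let q be a prime power, m a positive integer dividing q^n − 1, and V a k-dimensional 𝔽_q-subspace of 𝔽_{q^n} with subspace polynomial L_V(X) = X^{q^k} + Σ_{j=0}^{i} a_j X^{q^j}. Suppose a_s ≠ 0 for some s ∈ {1, …, i}, and set t := gcd(s, n). Then the number of distinct subspaces in the m-quasi orbit {α^m V : α ∈ 𝔽_{q^n}^*} is at least (q^n − 1)/(m(q^t − 1)); equivalently, m·(q^t − 1)·|{α^m V : α ∈ 𝔽_{q^n}^*}| ≥ q^n − 1. -/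
open Polynomial

theorem sp_comp {K F : Type*} [Field K] [Field F] [Algebra K F] [Fintype F]
    (V : Submodule K F) (g : F) (hg : g ≠ 0) (h : qshift g V = V) :
    (subspacePoly V).comp (C g * X) = C (g ^ Nat.card V) * subspacePoly V := by
  unfold subspacePoly
  rw [Polynomial.prod_comp]
  have hc : Nat.card V = (Set.toFinite (V : Set F)).toFinset.card := by
    rw [← Set.ncard_eq_toFinset_card]; rfl
  rw [hc, C_pow, ← Finset.prod_const, ← Finset.prod_mul_distrib]
  symm
  refine Finset.prod_bij (fun v _ => g * v) ?_ ?_ ?_ ?_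
  · intro v hv
    simp only [Set.Finite.mem_toFinset, SetLike.mem_coe] at hv ⊢
    rw [← h]
    exact ⟨v, hv, rfl⟩
  · intro v _ w _ e
    exact mul_left_cancel₀ hg e
  · intro v hv
    simp only [Set.Finite.mem_toFinset, SetLike.mem_coe] at hv ⊢
    rw [← h] at hv
    obtain ⟨w, hw, e⟩ := hv
    exact ⟨w, hw, e⟩
  · intro v _
    simp [mul_sub]

theorem sp_coeff_one {K F : Type*} [Field K] [Field F] [Algebra K F] [Fintype F]
    (V : Submodule K F) : (subspacePoly V).coeff 1 ≠ 0 := by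
  classical
  unfold subspacePoly
  have h0 : (0 : F) ∈ (Set.toFinite (V : Set F)).toFinset := by simp
  rw [← Finset.mul_prod_erase _ _ h0]
  simp only [map_zero, sub_zero]
  rw [show (1 : ℕ) = 0 + 1 from rfl, coeff_X_mul, coeff_zero_eq_eval_zero, eval_prod,
    Finset.prod_ne_zero_iff]
  intro v hv
  simpa using Finset.ne_of_mem_erase hv

theorem qshift_mul {K F : Type*} [Field K] [Field F] [Algebra K F]
    (a b : F) (V : Submodule K F) : qshift (a * b) V = qshift a (qshift b V) := by
  unfold qshift
  rw [← Submodule.map_comp, LinearMap.mulLeft_mul]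

theorem qshift_one {K F : Type*} [Field K] [Field F] [Algebra K F]
    (V : Submodule K F) : qshift (1 : F) V = V := by
  unfold qshift
  rw [LinearMap.mulLeft_one, Submodule.map_id]

theorem quasi_orbit_size_lower_bound
    {K F : Type*} [Field K] [Fintype K] [Field F] [Fintype F] [Algebra K F]
    (q n m k i s : ℕ) (hq : Fintype.card K = q) (hn : 0 < n)
    (hF : Module.finrank K F = n) (hm : 0 < m) (hmdvd : m ∣ q ^ n - 1)
    (V : Submodule K F) (hVk : Module.finrank K ↥V = k) (hik : i < k)
    (a : ℕ → F)
    (hLV : subspacePoly V =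
      X ^ q ^ k + ∑ j ∈ Finset.range (i + 1), C (a j) * X ^ q ^ j)
    (hs1 : 1 ≤ s) (hsi : s ≤ i) (has : a s ≠ 0) :
    q ^ n - 1 ≤
      m * (q ^ Nat.gcd s n - 1) *
        Set.ncard {W : Submodule K F | ∃ α : F, α ≠ 0 ∧ W = qshift (α ^ m) V} := by
  classical
  have hq2 : 1 < q := hq ▸ Fintype.one_lt_card
  have hcV : Nat.card V = q ^ k := by
    rw [Module.natCard_eq_pow_finrank (K := K), hVk, Nat.card_eq_fintype_card, hq]
  have hcF : Fintype.card F = q ^ n := by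
    rw [Module.card_eq_pow_finrank (K := K), hF, hq]
  have hcs : (subspacePoly V).coeff (q ^ s) = a s := by
    rw [hLV, coeff_add, coeff_X_pow, finsetSum_coeff]
    have h1 : q ^ s ≠ q ^ k := fun e => by
      have := Nat.pow_right_injective hq2 e
      omega
    rw [if_neg h1, zero_add, Finset.sum_eq_single s]
    · simp
    · intro j _ hj
      have : q ^ s ≠ q ^ j := fun e => hj (Nat.pow_right_injective hq2 e).symm
      simp [coeff_X_pow, this]
    · intro h
      exact absurd (Finset.mem_range.2 (by omega)) h
  have hstab : ∀ g : F, g ≠ 0 → qshift g V = V → g ^ (q ^ Nat.gcd s n - 1) = 1 := by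
    intro g hg h
    have hc := sp_comp V g hg h
    rw [hcV] at hc
    have e1 := congrArg (fun p => coeff p 1) hc
    have e2 := congrArg (fun p => coeff p (q ^ s)) hc
    simp only [comp_C_mul_X_coeff, coeff_C_mul] at e1 e2
    rw [mul_comm] at e1 e2
    have e1' := mul_right_cancel₀ (sp_coeff_one V) e1
    have e2' := mul_right_cancel₀ (hcs ▸ has) e2
    rw [← e1', pow_one] at e2'
    have key : ∀ r : ℕ, g ^ q ^ r = g → orderOf g ∣ q ^ r - 1 := by
      intro r hr
      apply orderOf_dvd_of_pow_eq_one
      apply mul_right_cancel₀ hg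
      rw [← pow_succ, Nat.sub_add_cancel (Nat.pos_of_ne_zero (by positivity)), hr, one_mul]
    have k1 := key s e2'
    have k2 := key n (by rw [← hcF]; exact FiniteField.pow_card g)
    have := Nat.dvd_gcd k1 k2
    rw [Nat.pow_sub_one_gcd_pow_sub_one] at this
    exact orderOf_dvd_iff_pow_eq_one.1 this
  set S := {W : Submodule K F | ∃ α : F, α ≠ 0 ∧ W = qshift (α ^ m) V} with hS
  let f : Fˣ → Submodule K F := fun α => qshift ((α : F) ^ m) V
  have hSf : S = ((Finset.univ.image f : Finset (Submodule K F)) : Set (Submodule K F)) := by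
    ext W
    simp only [hS, f, Set.mem_ofPred_eq, Finset.coe_image, Finset.coe_univ, Set.image_univ,
      Set.mem_range]
    constructor
    · rintro ⟨α, h0, rfl⟩
      exact ⟨Units.mk0 α h0, rfl⟩
    · rintro ⟨α, rfl⟩
      exact ⟨α, α.ne_zero, rfl⟩
  have hcU : (Finset.univ : Finset Fˣ).card = q ^ n - 1 := by
    rw [Finset.card_univ, Fintype.card_units, hcF]
  rw [hSf, Set.ncard_coe_finset, ← hcU]
  have hgp : 0 < Nat.gcd s n := Nat.gcd_pos_of_pos_right _ hn
  have hQ : 0 < q ^ Nat.gcd s n - 1 := Nat.sub_pos_of_lt (Nat.one_lt_pow hgp.ne' hq2)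
  apply Finset.card_le_mul_card_image
  intro W hW
  obtain ⟨b, _, rfl⟩ := Finset.mem_image.1 hW
  calc _ ≤ (nthRoots (m * (q ^ Nat.gcd s n - 1)) (1 : F)).toFinset.card := by
        apply Finset.card_le_card_of_injOn (fun α : Fˣ => (α : F) * (b : F)⁻¹)
        · intro α hα
          have hα' : qshift ((α : F) ^ m) V = qshift ((b : F) ^ m) V := by simpa [f] using hα
          have hb : (b : F) ≠ 0 := b.ne_zero
          have ha : (α : F) ≠ 0 := α.ne_zero
          simp only [Finset.mem_coe, Multiset.mem_toFinset]
          rw [mem_nthRoots (Nat.mul_pos hm hQ), pow_mul]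
          apply hstab
          · exact pow_ne_zero _ (mul_ne_zero ha (inv_ne_zero hb))
          · rw [mul_pow, mul_comm, qshift_mul, hα', ← qshift_mul, ← mul_pow,
              inv_mul_cancel₀ hb, one_pow, qshift_one]
        · intro x _ y _ e
          exact Units.ext (mul_right_cancel₀ (inv_ne_zero b.ne_zero) e)
    _ ≤ _ := (Multiset.toFinset_card_le _).trans (card_nthRoots _ _)
end
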